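/- arXiv:2202.12035 — 3 statements merged into one kernel-verified Lean document; each statement's English description precedes it below -/
import Mathlib

section
/- Let A be a bisymmetric payoff tensor on Sym_m × Sym_n and let V = sup_{X∈𝒳_m} inf_{Y∈𝒳_n} p_A(X,Y) be the value of the associated semidefinite zero-sum game. Then a matrix X ∈ Sym_m is an optimal strategy of player 1 (i.e., X ∈ 𝒳_m and p_A(X,Y) ≥ V for all Y ∈ 𝒳_n) if and only if X is positive semidefinite, tr(X) = 1, and A(X) − V·I_n is positive semidefinite. In particular, the set of optimal strategies of player 1 is a spectrahedron, given by the explicit linear matrix inequality description S₁ = { X ∈ Sym_m : X ⪰ 0, tr(X) = 1, A(X) − V·I_n ⪰ 0 }. -/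
open Matrix BigOperators

/-- The spectraplex: real symmetric positive semidefinite `n×n` matrices with trace 1. -/
def Spectraplex (n : ℕ) : Set (Matrix (Fin n) (Fin n) ℝ) :=
  {X | X.IsSymm ∧ X.PosSemidef ∧ X.trace = 1}

/-- The payoff function of a semidefinite game with payoff tensor `A`. -/
def payoff {m n : ℕ} (A : Fin m → Fin m → Fin n → Fin n → ℝ)
    (X : Matrix (Fin m) (Fin m) ℝ) (Y : Matrix (Fin n) (Fin n) ℝ) : ℝ :=
  ∑ i, ∑ j, ∑ k, ∑ l, X i j * A i j k l * Y k l

/-- A bisymmetric payoff tensor. -/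
def Bisymm {m n : ℕ} (A : Fin m → Fin m → Fin n → Fin n → ℝ) : Prop :=
  ∀ i j k l, A i j k l = A j i k l ∧ A i j k l = A i j l k

/-- The slice matrix `A(X) ∈ Sym_n`, with entries `A(X)_{kl} = Σ_{i,j} X_{ij} A_{ijkl}`. -/
def sliceX {m n : ℕ} (A : Fin m → Fin m → Fin n → Fin n → ℝ)
    (X : Matrix (Fin m) (Fin m) ℝ) : Matrix (Fin n) (Fin n) ℝ :=
  Matrix.of fun k l => ∑ i, ∑ j, X i j * A i j k l

theorem Matrix.PosSemidef.trace_mul_nonneg {ι : Type*} [Fintype ι] {M Y : Matrix ι ι ℝ}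
    (hM : M.PosSemidef) (hY : Y.PosSemidef) : 0 ≤ (M * Y).trace := by
  obtain ⟨r, v, rfl⟩ := Matrix.posSemidef_iff_eq_sum_vecMulVec.mp hY
  rw [Matrix.mul_sum, Matrix.trace_sum]
  refine Finset.sum_nonneg fun i _ => ?_
  rw [Matrix.mul_vecMulVec, Matrix.trace_vecMulVec, dotProduct_comm]
  exact hM.dotProduct_mulVec_nonneg (v i)

/-- A real symmetric matrix is positive semidefinite iff its trace pairing with every element of
the spectraplex is nonnegative. -/
theorem Matrix.IsSymm.posSemidef_iff_forall_spectraplex {n : ℕ} {M : Matrix (Fin n) (Fin n) ℝ}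
    (hM : M.IsSymm) : M.PosSemidef ↔ ∀ Y ∈ Spectraplex n, 0 ≤ (M * Y).trace := by
  refine ⟨fun h Y hY => h.trace_mul_nonneg hY.2.1, fun h => ?_⟩
  refine .of_dotProduct_mulVec_nonneg (by rwa [IsHermitian, conjTranspose_eq_transpose_of_trivial])
    fun v => ?_
  rw [star_trivial]
  rcases eq_or_ne v 0 with rfl | hv
  · simp
  have hpos : 0 < v ⬝ᵥ v := by
    simpa using dotProduct_star_self_pos_iff.mpr hv
  have hY : (v ⬝ᵥ v)⁻¹ • vecMulVec v v ∈ Spectraplex n := by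
    refine ⟨?_, ?_, ?_⟩
    · simp [IsSymm, transpose_vecMulVec]
    · have hv : (vecMulVec v v).PosSemidef := by simpa using posSemidef_vecMulVec_self_star v
      exact hv.smul (inv_nonneg.mpr hpos.le)
    · rw [trace_smul, trace_vecMulVec, smul_eq_mul, inv_mul_cancel₀ hpos.ne']
  have h' := h _ hY
  rw [Matrix.mul_smul, trace_smul, mul_vecMulVec, trace_vecMulVec, smul_eq_mul,
    dotProduct_comm (M *ᵥ v)] at h'
  exact nonneg_of_mul_nonneg_right h' (inv_pos.mpr hpos)

theorem sliceX_isSymm {m n : ℕ} {A : Fin m → Fin m → Fin n → Fin n → ℝ} (hA : Bisymm A)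
    (X : Matrix (Fin m) (Fin m) ℝ) : (sliceX A X).IsSymm := by
  ext k l
  simp only [sliceX, transpose_apply, of_apply]
  exact Finset.sum_congr rfl fun i _ => Finset.sum_congr rfl fun j _ => by rw [(hA i j l k).2]

theorem payoff_eq_trace_sliceX_mul {m n : ℕ} (A : Fin m → Fin m → Fin n → Fin n → ℝ)
    (X : Matrix (Fin m) (Fin m) ℝ) {Y : Matrix (Fin n) (Fin n) ℝ} (hY : Y.IsSymm) :
    payoff A X Y = (sliceX A X * Y).trace := by
  simp only [payoff, trace, diag_apply, mul_apply, sliceX, of_apply, Finset.sum_mul]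
  simp_rw [Finset.sum_comm (s := (Finset.univ : Finset (Fin m)))
    (t := (Finset.univ : Finset (Fin n)))]
  simp only [hY.apply]

theorem optimal_strategies_player1_spectrahedron {m n : ℕ} (hm : 1 ≤ m) (hn : 1 ≤ n)
    (A : Fin m → Fin m → Fin n → Fin n → ℝ) (hA : Bisymm A) (V : ℝ)
    (hV : V = ⨆ X : Spectraplex m, ⨅ Y : Spectraplex n, payoff A X.1 Y.1) :
    ∀ X : Matrix (Fin m) (Fin m) ℝ,
      (X ∈ Spectraplex m ∧ ∀ Y ∈ Spectraplex n, V ≤ payoff A X Y) ↔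
      (X.IsSymm ∧ X.PosSemidef ∧ X.trace = 1 ∧
        (sliceX A X - V • (1 : Matrix (Fin n) (Fin n) ℝ)).PosSemidef) := by
  intro X
  have hsymm : (sliceX A X - V • (1 : Matrix (Fin n) (Fin n) ℝ)).IsSymm :=
    (sliceX_isSymm hA X).sub (isSymm_one.smul V)
  have hpair : ∀ Y ∈ Spectraplex n,
      (0 ≤ ((sliceX A X - V • (1 : Matrix (Fin n) (Fin n) ℝ)) * Y).trace ↔
        V ≤ payoff A X Y) := fun Y hY => by
    rw [payoff_eq_trace_sliceX_mul A X hY.1, Matrix.sub_mul, trace_sub, Matrix.smul_mul,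
      Matrix.one_mul, trace_smul, hY.2.2, smul_eq_mul, mul_one, sub_nonneg]
  rw [hsymm.posSemidef_iff_forall_spectraplex, forall₂_congr hpair]
  simp only [Spectraplex, Set.mem_ofPred_eq, and_assoc]
end

section
/- Let A be a bisymmetric payoff tensor on Sym_m × Sym_n and let V = inf_{Y∈𝒳_n} sup_{X∈𝒳_m} p_A(X,Y) be the value of the associated semidefinite zero-sum game. Then a matrix Y ∈ Sym_n is an optimal strategy of player 2 (i.e., Y ∈ 𝒳_n and p_A(X,Y) ≤ V for all X ∈ 𝒳_m) if and only if Y is positive semidefinite, tr(Y) = 1, and V·I_m − Aᵀ(Y) is positive semidefinite. In particular, the set of optimal strategies of player 2 is a spectrahedron, given by the explicit linear matrix inequality description S₂ = { Y ∈ Sym_n : Y ⪰ 0, tr(Y) = 1, V·I_m − Aᵀ(Y) ⪰ 0 }. -/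
open Matrix BigOperators

/-- The slice matrix `Aᵀ(Y) ∈ Sym_m`, with entries `Aᵀ(Y)_{ij} = Σ_{k,l} A_{ijkl} Y_{kl}`. -/
def sliceY {m n : ℕ} (A : Fin m → Fin m → Fin n → Fin n → ℝ)
    (Y : Matrix (Fin n) (Fin n) ℝ) : Matrix (Fin m) (Fin m) ℝ :=
  Matrix.of fun i j => ∑ k, ∑ l, A i j k l * Y k l

theorem payoff_eq_sum_mul_sliceY {m n : ℕ} (A : Fin m → Fin m → Fin n → Fin n → ℝ)
    (X : Matrix (Fin m) (Fin m) ℝ) (Y : Matrix (Fin n) (Fin n) ℝ) :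
    payoff A X Y = ∑ i, ∑ j, X i j * sliceY A Y i j := by
  simp only [payoff, sliceY, Matrix.of_apply, Finset.mul_sum, mul_assoc]

theorem payoff_eq_trace {m n : ℕ} (A : Fin m → Fin m → Fin n → Fin n → ℝ)
    {X : Matrix (Fin m) (Fin m) ℝ} (hX : X.IsSymm) (Y : Matrix (Fin n) (Fin n) ℝ) :
    payoff A X Y = (X * sliceY A Y).trace := by
  rw [payoff_eq_sum_mul_sliceY, Finset.sum_comm]
  simp only [Matrix.trace, Matrix.diag_apply, Matrix.mul_apply]
  exact Finset.sum_congr rfl fun i _ => Finset.sum_congr rfl fun j _ => by rw [hX.apply]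

theorem sliceY_isSymm {m n : ℕ} {A : Fin m → Fin m → Fin n → Fin n → ℝ} (hA : Bisymm A)
    (Y : Matrix (Fin n) (Fin n) ℝ) : (sliceY A Y).IsSymm := by
  ext i j
  simp only [sliceY, Matrix.transpose_apply, Matrix.of_apply]
  exact Finset.sum_congr rfl fun k _ => Finset.sum_congr rfl fun l _ => by rw [(hA j i k l).1]

open scoped MatrixOrder in
theorem trace_mul_nonneg_of_posSemidef {ι : Type*} [Fintype ι] [DecidableEq ι]
    {X M : Matrix ι ι ℝ} (hX : X.PosSemidef) (hM : M.PosSemidef) : 0 ≤ (X * M).trace := by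
  obtain ⟨B, rfl⟩ := CStarAlgebra.nonneg_iff_eq_star_mul_self.mp hX.nonneg
  rw [Matrix.mul_assoc, Matrix.trace_mul_comm]
  exact (hM.mul_mul_conjTranspose_same B).trace_nonneg

theorem inv_smul_vecMulVec_mem_spectraplex {m : ℕ} {v : Fin m → ℝ} (hv : v ≠ 0) :
    (v ⬝ᵥ v)⁻¹ • Matrix.vecMulVec v v ∈ Spectraplex m := by
  have hpos : 0 < v ⬝ᵥ v := by simpa using Matrix.dotProduct_star_self_pos_iff.mpr hv
  refine ⟨?_, ?_, ?_⟩
  · ext i j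
    simp [Matrix.vecMulVec_apply, mul_comm]
  · have h := Matrix.posSemidef_vecMulVec_self_star v
    rw [star_trivial] at h
    exact h.smul (inv_nonneg.mpr hpos.le)
  · rw [Matrix.trace_smul, Matrix.trace_vecMulVec, smul_eq_mul, inv_mul_cancel₀ hpos.ne']

theorem optimal_strategies_player2_spectrahedron {m n : ℕ} (hm : 1 ≤ m) (hn : 1 ≤ n)
    (A : Fin m → Fin m → Fin n → Fin n → ℝ) (hA : Bisymm A) (V : ℝ)
    (hV : V = ⨅ Y : Spectraplex n, ⨆ X : Spectraplex m, payoff A X.1 Y.1) :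
    ∀ Y : Matrix (Fin n) (Fin n) ℝ,
      (Y ∈ Spectraplex n ∧ ∀ X ∈ Spectraplex m, payoff A X Y ≤ V) ↔
      (Y.IsSymm ∧ Y.PosSemidef ∧ Y.trace = 1 ∧
        (V • (1 : Matrix (Fin m) (Fin m) ℝ) - sliceY A Y).PosSemidef) := by
  intro Y
  constructor
  · rintro ⟨⟨hs, hp, ht⟩, hopt⟩
    refine ⟨hs, hp, ht, Matrix.PosSemidef.of_dotProduct_mulVec_nonneg ?_ fun v => ?_⟩
    · rw [Matrix.IsHermitian, Matrix.conjTranspose_eq_transpose_of_trivial,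
        Matrix.transpose_sub, (sliceY_isSymm hA Y).eq, Matrix.transpose_smul,
        Matrix.transpose_one]
    · rcases eq_or_ne v 0 with rfl | hv
      · simp
      have hpos : 0 < v ⬝ᵥ v := by simpa using Matrix.dotProduct_star_self_pos_iff.mpr hv
      have hX := inv_smul_vecMulVec_mem_spectraplex hv
      have h := hopt _ hX
      rw [payoff_eq_trace A hX.1, Matrix.smul_mul, Matrix.trace_smul, smul_eq_mul,
        Matrix.trace_mul_comm, Matrix.mul_vecMulVec, Matrix.trace_vecMulVec,
        inv_mul_le_iff₀ hpos, dotProduct_comm] at h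
      rw [star_trivial, Matrix.sub_mulVec, Matrix.smul_mulVec, Matrix.one_mulVec,
        dotProduct_sub, dotProduct_smul, smul_eq_mul]
      linarith
  · rintro ⟨hs, hp, ht, hM⟩
    refine ⟨⟨hs, hp, ht⟩, fun X hX => ?_⟩
    have h := trace_mul_nonneg_of_posSemidef hX.2.1 hM
    rw [Matrix.mul_sub, Matrix.trace_sub, Matrix.mul_smul, Matrix.mul_one, Matrix.trace_smul,
      hX.2.2, smul_eq_mul, mul_one, ← payoff_eq_trace A hX.1] at h
    linarith
end

section
/- Let A₁, …, A_m, C ∈ Sym_n and b ∈ ℝ^m, and let (ȳ, X̄, t̄) be a solution of the associated semidefinite Dantzig game: ȳ ≥ 0 componentwise, X̄ ⪰ 0, t̄ ≥ 0, 𝟙ᵀȳ + tr(X̄) + t̄ = 1, ⟨A_i, X̄⟩ − b_i t̄ ≥ 0 for all i, t̄·C − Σ_{j=1}^m ȳ_j A_j ⪰ 0, and bᵀȳ − ⟨C, X̄⟩ ≥ 0. If bᵀȳ − ⟨C, X̄⟩ > 0, then the primal problem or the dual problem is infeasible: either there is no X ∈ Sym_n with X ⪰ 0 and ⟨A_i,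 X⟩ ≥ b_i for all i, or there is no y ∈ ℝ^m with y ≥ 0 and C − Σ_i y_i A_i ⪰ 0. -/
open Matrix BigOperators

/-- The Frobenius inner product `⟨M, N⟩ = Σ_{i,j} M_{ij} N_{ij}`. -/
def frob {n : ℕ} (M N : Matrix (Fin n) (Fin n) ℝ) : ℝ :=
  ∑ i, ∑ j, M i j * N i j

theorem frob_eq_trace_mul_transpose {n : ℕ} (M N : Matrix (Fin n) (Fin n) ℝ) :
    frob M N = (M * Nᵀ).trace := by
  simp [frob, Matrix.trace, Matrix.mul_apply]

/-- The cone of positive semidefinite matrices is contained in its dual cone. -/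
theorem frob_nonneg {n : ℕ} {M N : Matrix (Fin n) (Fin n) ℝ}
    (hM : M.PosSemidef) (hN : N.PosSemidef) : 0 ≤ frob M N := by
  obtain ⟨B, rfl⟩ : ∃ B : Matrix (Fin n) (Fin n) ℝ, N = Bᴴ * B := by
    open scoped MatrixOrder in
    exact CStarAlgebra.nonneg_iff_eq_star_mul_self.mp hN.nonneg
  have h := (hM.mul_mul_conjTranspose_same B).trace_nonneg
  rwa [Matrix.mul_assoc, Matrix.trace_mul_comm, Matrix.mul_assoc,
    show Bᴴ * B = (Bᴴ * B)ᵀ by simp [Matrix.transpose_mul],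
    ← frob_eq_trace_mul_transpose] at h

theorem frob_smul_sub_sum {m n : ℕ} (t : ℝ) (y : Fin m → ℝ) (C X : Matrix (Fin n) (Fin n) ℝ)
    (A : Fin m → Matrix (Fin n) (Fin n) ℝ) :
    frob (t • C - ∑ j, y j • A j) X = t * frob C X - ∑ j, y j * frob (A j) X := by
  simp [frob_eq_trace_mul_transpose, Matrix.sub_mul, Matrix.sum_mul, Matrix.trace_sum]

theorem dantzig_game_infeasibility {m n : ℕ}
    (A : Fin m → Matrix (Fin n) (Fin n) ℝ) (C : Matrix (Fin n) (Fin n) ℝ)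
    (b : Fin m → ℝ)
    (hAsym : ∀ i, (A i).IsSymm) (hCsym : C.IsSymm)
    (ybar : Fin m → ℝ) (Xbar : Matrix (Fin n) (Fin n) ℝ) (tbar : ℝ)
    (hy : ∀ i, 0 ≤ ybar i) (hX : Xbar.PosSemidef) (ht : 0 ≤ tbar)
    (htr : (∑ i, ybar i) + Xbar.trace + tbar = 1)
    (h1 : ∀ i, 0 ≤ frob (A i) Xbar - b i * tbar)
    (h2 : (tbar • C - ∑ j, ybar j • A j).PosSemidef)
    (h3 : 0 < (∑ i, b i * ybar i) - frob C Xbar) :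
    (¬ ∃ X : Matrix (Fin n) (Fin n) ℝ, X.PosSemidef ∧ ∀ i, b i ≤ frob (A i) X) ∨
    (¬ ∃ y : Fin m → ℝ, (∀ i, 0 ≤ y i) ∧ (C - ∑ i, y i • A i).PosSemidef) := by
  rw [← not_and_or]
  rintro ⟨⟨X, hXf, hAX⟩, y, hyf, hCy⟩
  rcases ht.eq_or_lt with rfl | ht
  · have hC : 0 ≤ frob C Xbar - ∑ j, y j * frob (A j) Xbar := by
      rw [← one_mul (frob C Xbar), ← frob_smul_sub_sum, one_smul]
      exact frob_nonneg hCy hX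
    have hA : 0 ≤ ∑ j, y j * frob (A j) Xbar :=
      Finset.sum_nonneg fun j _ => mul_nonneg (hyf j) (by simpa using h1 j)
    have hS := frob_nonneg h2 hXf
    rw [frob_smul_sub_sum] at hS
    have hb : ∑ j, b j * ybar j ≤ ∑ j, ybar j * frob (A j) X :=
      Finset.sum_le_sum fun j _ => by
        rw [mul_comm]
        exact mul_le_mul_of_nonneg_left (hAX j) (hy j)
    linarith
  · have hS := frob_nonneg h2 hX
    rw [frob_smul_sub_sum] at hS
    have hb : tbar * ∑ j, b j * ybar j ≤ ∑ j, ybar j * frob (A j) Xbar := by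
      rw [Finset.mul_sum]
      refine Finset.sum_le_sum fun j _ => ?_
      linarith [mul_nonneg (hy j) (h1 j)]
    linarith [mul_pos ht h3]
end
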